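/- arXiv:2307.06317 — 7 statements merged into one kernel-verified Lean document; each statement's English description precedes it below -/
import Mathlib

section
/- Let v ∈ ℤ³ be a nonzero vector whose entries have gcd equal to 1, let p ∈ ℝ³, and let L = {p + t·v : t ∈ ℝ} be the line through p with direction v. Then the image 𝒫(L), equipped with the subspace topology from 𝕋³, is a closed subset of 𝕋³ that is homeomorphic to the circle ℝ/ℤ. (Thus every line with primitive integral direction projects to a rod-shaped circle in the 3-torus.) -/
/-- The 3-torus `(ℝ/ℤ)³`. -/
abbrev T3 : Type := Fin 3 → AddCircle (1 : ℝ)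

/-- The componentwise quotient map `𝒫 : ℝ³ → 𝕋³`. -/
noncomputable def P (x : Fin 3 → ℝ) : T3 := fun i => (x i : AddCircle (1 : ℝ))

/-- Multiplication by a primitive integer vector, `a ↦ (v i • a)ᵢ`, is injective on any
additive group. -/
theorem zsmul_primitive_injective {A : Type*} [AddCommGroup A] {v : Fin 3 → ℤ}
    (hgcd : Int.gcd (v 0) (Int.gcd (v 1) (v 2)) = 1) :
    Function.Injective fun (a : A) (i : Fin 3) => v i • a := by
  intro a b hab
  obtain ⟨x, y, z, h⟩ : ∃ x y z : ℤ, x * v 0 + y * v 1 + z * v 2 = 1 := by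
    have outer := Int.gcd_eq_gcd_ab (v 0) (Int.gcd (v 1) (v 2))
    have inner := Int.gcd_eq_gcd_ab (v 1) (v 2)
    rw [hgcd] at outer
    generalize Int.gcdA (v 0) _ = r, Int.gcdB (v 0) _ = k at outer
    refine ⟨r, k * Int.gcdA (v 1) (v 2), k * Int.gcdB (v 1) (v 2), ?_⟩
    push_cast at outer
    linear_combination -outer - k * inner
  have key (c : A) : c = x • v 0 • c + y • v 1 • c + z • v 2 • c := by
    simp only [← mul_smul, ← add_smul, h, one_smul]
  have hi (i : Fin 3) : v i • a = v i • b := congrFun hab i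
  rw [key a, key b, hi, hi, hi]

/-- The translate by `q` of the one-parameter subgroup of the torus in a primitive direction
is a closed embedding of the circle. -/
theorem isClosedEmbedding_add_zsmul_primitive {v : Fin 3 → ℤ}
    (hgcd : Int.gcd (v 0) (Int.gcd (v 1) (v 2)) = 1) (q : T3) :
    Topology.IsClosedEmbedding
      fun s : AddCircle (1 : ℝ) => q + fun i => v i • s :=
  Continuous.isClosedEmbedding (by fun_prop)
    ((add_right_injective q).comp (zsmul_primitive_injective hgcd))

theorem image_P_line (v : Fin 3 → ℤ) (p : Fin 3 → ℝ) :
    P '' {x | ∃ t : ℝ, x = p + t • fun i => ((v i : ℤ) : ℝ)} =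
      Set.range fun s : AddCircle (1 : ℝ) => P p + fun i => v i • s := by
  have hP (t : ℝ) : P (p + t • fun i => ((v i : ℤ) : ℝ)) =
      P p + fun i => v i • (t : AddCircle (1 : ℝ)) := by
    ext i
    simp [P, mul_comm t, ← zsmul_eq_mul]
  ext y
  constructor
  · rintro ⟨_, ⟨t, rfl⟩, rfl⟩
    exact ⟨t, (hP t).symm⟩
  · rintro ⟨s, rfl⟩
    obtain ⟨t, rfl⟩ := QuotientAddGroup.mk_surjective s
    exact ⟨_, ⟨t, rfl⟩, hP t⟩

/-- **Lines with primitive integral direction project to rod-shaped circles.**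
If `v ∈ ℤ³` is nonzero with `gcd` of its entries equal to `1`, `p ∈ ℝ³`, and
`L = {p + t • v : t ∈ ℝ}`, then `𝒫(L)` is a closed subset of `𝕋³` which, with
the subspace topology, is homeomorphic to the circle `ℝ/ℤ`. -/
theorem image_line_primitive_direction_closed_and_homeomorphic_circle
    (v : Fin 3 → ℤ) (hv : v ≠ 0)
    (hgcd : Int.gcd (v 0) (Int.gcd (v 1) (v 2)) = 1)
    (p : Fin 3 → ℝ)
    (L : Set (Fin 3 → ℝ))
    (hL : L = {x | ∃ t : ℝ, x = p + t • fun i => ((v i : ℤ) : ℝ)}) :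
    IsClosed (P '' L) ∧ Nonempty ((P '' L) ≃ₜ AddCircle (1 : ℝ)) := by
  have hf := isClosedEmbedding_add_zsmul_primitive hgcd (P p)
  rw [hL, image_P_line]
  exact ⟨hf.isClosed_range, ⟨hf.isEmbedding.toHomeomorph.symm⟩⟩
end

section
/- Let v₁ = (a,b,c) and v₂ = (m,n,r) be linearly independent vectors in ℤ³. The map ψ : (ℝ/ℤ)² → 𝕋³ induced by (s,t) ↦ 𝒫(s·v₁ + t·v₂) is injective if and only if gcd(a·n − b·m, b·r − c·n, a·r − c·m) = 1, i.e. if and only if the gcd of the three 2×2 minors of the 3×2 integer matrix with columns v₁, v₂ (equivalently, of the components of the cross product v₁ × v₂) equals 1. -/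
theorem AddCircle.coe_one_eq_coe_iff (x y : ℝ) :
    (x : AddCircle (1 : ℝ)) = y ↔ ∃ k : ℤ, x - y = k := by
  rw [← sub_eq_zero, ← AddCircle.coe_sub, AddCircle.coe_eq_zero_iff]
  simp [eq_comm]

theorem P_eq_iff (x y : Fin 3 → ℝ) : P x = P y ↔ ∀ i, ∃ k : ℤ, x i - y i = k := by
  simp only [P, funext_iff, AddCircle.coe_one_eq_coe_iff]

/-- The linear combinations of two integer vectors that lie in the integer lattice have integer
coefficients if and only if the map induced on the torus is injective. -/
theorem planeTorus_param_injective_iff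
    (v w : Fin 3 → ℤ) (ψ : AddCircle (1 : ℝ) × AddCircle (1 : ℝ) → T3)
    (hψ : ∀ s t : ℝ, ψ ((s : AddCircle (1 : ℝ)), (t : AddCircle (1 : ℝ))) =
      P (s • (fun i => (v i : ℝ)) + t • fun i => (w i : ℝ))) :
    Function.Injective ψ ↔ ∀ s t : ℝ, (∀ i, ∃ k : ℤ, s * v i + t * w i = k) →
      (∃ k : ℤ, s = k) ∧ ∃ l : ℤ, t = l := by
  constructor
  · intro h s t hst
    have key : ψ ((s : AddCircle (1 : ℝ)), (t : AddCircle (1 : ℝ))) =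
        ψ (((0 : ℝ) : AddCircle (1 : ℝ)), ((0 : ℝ) : AddCircle (1 : ℝ))) := by
      rw [hψ, hψ, P_eq_iff]
      simpa using hst
    have := h key
    rw [Prod.mk.injEq, AddCircle.coe_one_eq_coe_iff, AddCircle.coe_one_eq_coe_iff] at this
    simpa only [sub_zero] using this
  · rintro h ⟨x, y⟩ ⟨x', y'⟩ hxy
    obtain ⟨s, rfl⟩ := QuotientAddGroup.mk_surjective x
    obtain ⟨t, rfl⟩ := QuotientAddGroup.mk_surjective y
    obtain ⟨s', rfl⟩ := QuotientAddGroup.mk_surjective x'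
    obtain ⟨t', rfl⟩ := QuotientAddGroup.mk_surjective y'
    rw [hψ, hψ, P_eq_iff] at hxy
    rw [Prod.mk.injEq, AddCircle.coe_one_eq_coe_iff, AddCircle.coe_one_eq_coe_iff]
    refine h _ _ fun i => ?_
    obtain ⟨k, hk⟩ := hxy i
    refine ⟨k, ?_⟩
    simp only [Pi.add_apply, Pi.smul_apply, smul_eq_mul] at hk
    linarith

/-- If `p` divides all `2 × 2` minors, the two columns are linearly dependent modulo `p`. -/
theorem exists_linear_dependence_mod_of_dvd_minors {p a b c m n r : ℤ} (hp : ¬ p ∣ 1)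
    (h₁ : p ∣ a * n - b * m) (h₂ : p ∣ b * r - c * n) (h₃ : p ∣ a * r - c * m) :
    ∃ i j : ℤ, ¬ (p ∣ i ∧ p ∣ j) ∧
      p ∣ i * a + j * m ∧ p ∣ i * b + j * n ∧ p ∣ i * c + j * r := by
  by_cases ha : p ∣ a
  · by_cases hb : p ∣ b
    · by_cases hc : p ∣ c
      · exact ⟨1, 0, fun h => hp h.1, by simpa using ha, by simpa using hb, by simpa using hc⟩
      · refine ⟨r, -c, fun h => hc (dvd_neg.1 h.2), ?_, ?_, ?_⟩
        · exact h₃.trans (dvd_of_eq (by ring))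
        · exact h₂.trans (dvd_of_eq (by ring))
        · exact (dvd_zero p).trans (dvd_of_eq (by ring))
    · refine ⟨n, -b, fun h => hb (dvd_neg.1 h.2), ?_, ?_, ?_⟩
      · exact h₁.trans (dvd_of_eq (by ring))
      · exact (dvd_zero p).trans (dvd_of_eq (by ring))
      · exact (dvd_neg.2 h₂).trans (dvd_of_eq (by ring))
  · refine ⟨m, -a, fun h => ha (dvd_neg.1 h.2), ?_, ?_, ?_⟩
    · exact (dvd_zero p).trans (dvd_of_eq (by ring))
    · exact (dvd_neg.2 h₁).trans (dvd_of_eq (by ring))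
    · exact (dvd_neg.2 h₃).trans (dvd_of_eq (by ring))

theorem Int.exists_bezout_three {x y z : ℤ} (h : Int.gcd x (Int.gcd y z) = 1) :
    ∃ u v w : ℤ, u * x + v * y + w * z = 1 := by
  obtain ⟨u, q, huq⟩ := Int.isCoprime_iff_gcd_eq_one.2 h
  refine ⟨u, q * Int.gcdA y z, q * Int.gcdB y z, ?_⟩
  linear_combination huq - q * Int.gcd_eq_gcd_ab y z

/-- **Characterisation of embedded parametrized plane tori.**
Let `v₁ = (a,b,c)` and `v₂ = (m,n,r)` be linearly independent vectors in `ℤ³`.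
The map `ψ : (ℝ/ℤ)² → 𝕋³` induced by `(s,t) ↦ 𝒫(s•v₁ + t•v₂)` is injective iff
`gcd(a·n − b·m, b·r − c·n, a·r − c·m) = 1`, i.e. iff the gcd of the three 2×2
minors of the 3×2 matrix with columns `v₁, v₂` equals `1`. -/
theorem planeTorus_param_injective_iff_gcd_minors_eq_one
    (a b c m n r : ℤ)
    (hli : LinearIndependent ℝ
      ![(fun i => ((![a, b, c] i : ℤ) : ℝ)), (fun i => ((![m, n, r] i : ℤ) : ℝ))])
    (ψ : AddCircle (1 : ℝ) × AddCircle (1 : ℝ) → T3)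
    (hψ : ∀ s t : ℝ, ψ ((s : AddCircle (1 : ℝ)), (t : AddCircle (1 : ℝ))) =
      P (s • (fun i => ((![a, b, c] i : ℤ) : ℝ)) + t • fun i => ((![m, n, r] i : ℤ) : ℝ))) :
    Function.Injective ψ ↔
      Int.gcd (a * n - b * m) (Int.gcd (b * r - c * n) (a * r - c * m)) = 1 := by
  rw [planeTorus_param_injective_iff _ _ ψ hψ]
  simp only [Fin.forall_fin_succ, Fin.forall_fin_zero, Matrix.cons_val_zero, Matrix.cons_val_succ,
    and_true]
  constructor
  · intro h
    by_contra hg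
    obtain ⟨p, hp, hpg⟩ := Nat.exists_prime_and_dvd hg
    have hpg' := Int.natCast_dvd_natCast.2 hpg
    have h₁ := hpg'.trans (Int.gcd_dvd_left ..)
    have h' := hpg'.trans (Int.gcd_dvd_right ..)
    have hp₀ : (p : ℝ) ≠ 0 := Nat.cast_ne_zero.2 hp.ne_zero
    obtain ⟨i, j, hij, ⟨x, hx⟩, ⟨y, hy⟩, ⟨z, hz⟩⟩ :=
      exists_linear_dependence_mod_of_dvd_minors
        (fun h => (Nat.prime_iff_prime_int.1 hp).not_isUnit (isUnit_of_dvd_one h)) h₁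
        (h'.trans (Int.gcd_dvd_left ..)) (h'.trans (Int.gcd_dvd_right ..))
    have lift {e f k : ℤ} (hk : i * e + j * f = p * k) :
        (i / p : ℝ) * e + (j / p : ℝ) * f = k := by
      have : (i * e + j * f : ℝ) = p * k := mod_cast hk
      field_simp
      linarith
    obtain ⟨⟨k, hk⟩, l, hl⟩ := h (i / p) (j / p) ⟨⟨x, lift hx⟩, ⟨y, lift hy⟩, ⟨z, lift hz⟩⟩
    rw [div_eq_iff hp₀] at hk hl
    exact hij ⟨Dvd.intro_left k (mod_cast hk.symm), Dvd.intro_left l (mod_cast hl.symm)⟩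
  · rintro hg s t ⟨⟨x, hx⟩, ⟨y, hy⟩, ⟨z, hz⟩⟩
    obtain ⟨u, v, w, huvw⟩ := Int.exists_bezout_three hg
    have hR : (u * (a * n - b * m) + v * (b * r - c * n) + w * (a * r - c * m) : ℝ) = 1 :=
      mod_cast huvw
    refine ⟨⟨u * (x * n - y * m) + v * (y * r - z * n) + w * (x * r - z * m), ?_⟩,
      ⟨u * (a * y - b * x) + v * (b * z - c * y) + w * (a * z - c * x), ?_⟩⟩
    · push_cast
      rw [← hx, ← hy, ← hz]
      linear_combination (-s) * hR
    · push_cast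
      rw [← hx, ← hy, ← hz]
      linear_combination (-t) * hR
end

section
/- Let v₁, v₂ ∈ ℤ³ be linearly independent. Then the gcd of the three 2×2 minors of the 3×2 integer matrix with columns v₁, v₂ (equivalently, the gcd of the components of the cross product v₁ × v₂) equals 1 if and only if there exists v₃ ∈ ℤ³ such that the determinant of the 3×3 integer matrix with columns v₁, v₂, v₃ equals 1. (Unimodular completion criterion for a pair of integer vectors.) -/
/-- Bézout's identity for three integers. -/
theorem Int.gcd_gcd_eq_one_iff_exists (a b c : ℤ) :
    Int.gcd a (Int.gcd b c) = 1 ↔ ∃ x y z : ℤ, a * x + b * y + c * z = 1 := by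
  constructor
  · intro h
    have h₁ := Int.gcd_eq_gcd_ab a (Int.gcd b c)
    have h₂ := Int.gcd_eq_gcd_ab b c
    rw [h, Nat.cast_one] at h₁
    set u := Int.gcdA a (Int.gcd b c)
    set w := Int.gcdB a (Int.gcd b c)
    refine ⟨u, Int.gcdA b c * w, Int.gcdB b c * w, ?_⟩
    linear_combination -h₁ - w * h₂
  · rintro ⟨x, y, z, h⟩
    have ha : (Int.gcd a (Int.gcd b c) : ℤ) ∣ a := Int.gcd_dvd_left ..
    have hbc : (Int.gcd a (Int.gcd b c) : ℤ) ∣ Int.gcd b c := Int.gcd_dvd_right ..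
    have hb := hbc.trans (Int.gcd_dvd_left b c)
    have hc := hbc.trans (Int.gcd_dvd_right b c)
    have h_one : (Int.gcd a (Int.gcd b c) : ℤ) ∣ 1 :=
      h ▸ ((ha.mul_right x).add (hb.mul_right y)).add (hc.mul_right z)
    exact Nat.dvd_one.mp (by exact_mod_cast h_one)

/-- Expansion along the third column. -/
theorem Matrix.det_of_columns_fin_three {R : Type*} [CommRing R] (u v w : Fin 3 → R) :
    Matrix.det (Matrix.of fun i j => ![u, v, w] j i) =
      (u 0 * v 1 - u 1 * v 0) * w 2 + (u 1 * v 2 - u 2 * v 1) * w 0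
        + (u 0 * v 2 - u 2 * v 0) * -w 1 := by
  simp [Matrix.det_fin_three]
  ring

/-- **Unimodular completion criterion for a pair of integer vectors.**
Let `v₁, v₂ ∈ ℤ³` be linearly independent (over `ℝ`).  The gcd of the three
2×2 minors of the 3×2 matrix with columns `v₁, v₂` equals `1` iff there is a
third integer vector `v₃` such that the 3×3 matrix with columns `v₁, v₂, v₃`
has determinant `1`. -/
theorem gcd_minors_eq_one_iff_exists_unimodular_completion
    (v₁ v₂ : Fin 3 → ℤ)
    (hli : LinearIndependent ℝ
      ![(fun i => ((v₁ i : ℤ) : ℝ)), (fun i => ((v₂ i : ℤ) : ℝ))]) :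
    Int.gcd (v₁ 0 * v₂ 1 - v₁ 1 * v₂ 0)
      (Int.gcd (v₁ 1 * v₂ 2 - v₁ 2 * v₂ 1) (v₁ 0 * v₂ 2 - v₁ 2 * v₂ 0)) = 1 ↔
    ∃ v₃ : Fin 3 → ℤ,
      Matrix.det (Matrix.of fun i j => ![v₁, v₂, v₃] j i) = 1 := by
  simp only [Int.gcd_gcd_eq_one_iff_exists, Matrix.det_of_columns_fin_three]
  constructor
  · rintro ⟨x, y, z, h⟩
    exact ⟨![y, -z, x], by simpa using h⟩
  · rintro ⟨w, h⟩
    exact ⟨w 2, w 0, -w 1, h⟩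
end

section
/- Let Π be a 2-dimensional ℝ-linear subspace of ℝ³. Then the image 𝒫(Π) ⊆ 𝕋³, equipped with the subspace topology, is homeomorphic to the 2-torus (ℝ/ℤ)² if and only if there exist two linearly independent vectors v₁, v₂ ∈ ℤ³ such that Π is the ℝ-span of {v₁, v₂}. (A plane in the 3-torus is a plane torus exactly when it is spanned by two nonparallel integral vectors.) -/
/-- The projection `P` as a homomorphism of additive groups. -/
noncomputable def torusProj : (Fin 3 → ℝ) →+ T3 where
  toFun := P
  map_zero' := by ext i; simp [P]
  map_add' x y := by ext i; simp [P]

theorem continuous_torusProj : Continuous torusProj :=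
  continuous_pi fun i => (AddCircle.continuous_mk' 1).comp (continuous_apply i)

theorem torusProj_eq_zero_iff (x : Fin 3 → ℝ) :
    torusProj x = 0 ↔ ∃ v : Fin 3 → ℤ, x = fun i => (v i : ℝ) := by
  constructor
  · intro h
    have h' : ∀ i, ∃ n : ℤ, (n : ℝ) = x i := fun i => by
      have hi : ((x i : ℝ) : AddCircle (1 : ℝ)) = 0 := congrFun h i
      obtain ⟨n, hn⟩ := AddCircle.coe_eq_zero_iff (1 : ℝ) |>.1 hi
      exact ⟨n, by simpa using hn⟩
    choose v hv using h'
    exact ⟨v, funext fun i => (hv i).symm⟩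
  · rintro ⟨v, rfl⟩
    funext i
    exact AddCircle.coe_eq_zero_iff (1 : ℝ) |>.2 ⟨v i, by simp⟩

/-- The vectors of the subspace `V` with integer coordinates. -/
noncomputable def planeLattice (V : Submodule ℝ (Fin 3 → ℝ)) : Submodule ℤ V :=
  ZLattice.comap ℝ (Submodule.span ℤ (Set.range (Pi.basisFun ℝ (Fin 3)))) V.subtype

instance (V : Submodule ℝ (Fin 3 → ℝ)) : DiscreteTopology (planeLattice V) :=
  ZLattice.comap_discreteTopology ℝ _ continuous_subtype_val Subtype.val_injective

theorem mem_planeLattice_iff {V : Submodule ℝ (Fin 3 → ℝ)} (x : V) :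
    x ∈ planeLattice V ↔ torusProj x = 0 := by
  rw [torusProj_eq_zero_iff, planeLattice, ZLattice.comap, Submodule.mem_comap,
    Module.Basis.mem_span_iff_repr_mem]
  constructor
  · intro h
    choose v hv using h
    exact ⟨v, funext fun i => by simpa using (hv i).symm⟩
  · rintro ⟨v, hv⟩ i
    exact ⟨v i, by simp [hv]⟩

/-- If `P '' V` is compact, then the integral vectors of `V` span `V`. -/
theorem span_planeLattice_eq_top_of_isCompact {V : Submodule ℝ (Fin 3 → ℝ)}
    (hV : IsCompact (P '' (V : Set (Fin 3 → ℝ)))) :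
    Submodule.span ℝ (planeLattice V : Set V) = ⊤ := by
  by_contra hne
  obtain ⟨f, hf0, hf⟩ := Submodule.exists_dual_map_eq_bot_of_lt_top (lt_top_iff_ne_top.2 hne)
    inferInstance
  let g : V →+ T3 := torusProj.comp V.subtype.toAddMonoidHom
  have hg : Continuous g := continuous_torusProj.comp continuous_subtype_val
  have hrange : (g.range : Set T3) = P '' (V : Set (Fin 3 → ℝ)) := by
    ext y
    constructor
    · rintro ⟨x, rfl⟩
      exact ⟨x, x.2, rfl⟩
    · rintro ⟨x, hx, rfl⟩
      exact ⟨⟨x, hx⟩, rfl⟩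
  have : CompactSpace g.range := isCompact_iff_compactSpace.1 (hrange ▸ hV)
  have hrc : Continuous g.rangeRestrict := hg.subtype_mk _
  have hopen : IsOpenMap g.rangeRestrict :=
    g.rangeRestrict.isOpenMap_of_sigmaCompact g.rangeRestrict_surjective hrc
  let p : C(V, g.range) := ⟨g.rangeRestrict, hrc⟩
  have hquot : Topology.IsQuotientMap p :=
    hopen.isQuotientMap hrc g.rangeRestrict_surjective
  have hker : ∀ x y, g.rangeRestrict x = g.rangeRestrict y → f x = f y := by
    intro x y hxy
    have h : x - y ∈ planeLattice V := by
      rw [mem_planeLattice_iff]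
      have h' : g x = g y := congrArg Subtype.val hxy
      have : g (x - y) = 0 := by rw [map_sub, h', sub_self]
      exact this
    have h0 : f (x - y) ∈ Submodule.map f (Submodule.span ℝ (planeLattice V : Set V)) :=
      Submodule.mem_map_of_mem (Submodule.subset_span h)
    rw [hf, Submodule.mem_bot, map_sub] at h0
    exact sub_eq_zero.1 h0
  have hfc : Continuous f := f.continuous_of_finiteDimensional
  let F : C(g.range, ℝ) := hquot.lift ⟨f, hfc⟩ hker
  have hF : ∀ x, F (g.rangeRestrict x) = f x := fun x =>
    DFunLike.congr_fun (hquot.lift_comp ⟨f, hfc⟩ hker) x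
  have hFs : Function.Surjective F := fun t => by
    obtain ⟨x, hx⟩ := LinearMap.surjective hf0 t
    exact ⟨g.rangeRestrict x, (hF x).trans hx⟩
  have hc := isCompact_range F.continuous
  rw [hFs.range_eq] at hc
  exact noncompact_univ ℝ hc

/-- The homomorphism from the circle to `T3` tracing the image of the line through an integral
vector. -/
noncomputable def circleHom (v : Fin 3 → ℝ) (hv : torusProj v = 0) :
    AddCircle (1 : ℝ) →+ T3 :=
  QuotientAddGroup.lift _ (torusProj.comp (LinearMap.toSpanSingleton ℝ _ v).toAddMonoidHom) <| by
    rw [AddSubgroup.zmultiples_le]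
    simpa [AddMonoidHom.mem_ker] using hv

theorem circleHom_coe (v : Fin 3 → ℝ) (hv : torusProj v = 0) (t : ℝ) :
    circleHom v hv (t : AddCircle (1 : ℝ)) = torusProj (t • v) := rfl

theorem continuous_circleHom (v : Fin 3 → ℝ) (hv : torusProj v = 0) :
    Continuous (circleHom v hv) :=
  continuous_quot_lift _ (continuous_torusProj.comp (continuous_id.smul continuous_const))

/-- If the integral vectors of the plane `V` span it, then `P '' V` is a 2-torus. -/
theorem nonempty_homeomorph_of_span_planeLattice_eq_top {V : Submodule ℝ (Fin 3 → ℝ)}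
    (hdim : Module.finrank ℝ V = 2)
    (hV : Submodule.span ℝ (planeLattice V : Set V) = ⊤) :
    Nonempty ((P '' (V : Set (Fin 3 → ℝ))) ≃ₜ (AddCircle (1 : ℝ) × AddCircle (1 : ℝ))) := by
  have : IsZLattice ℝ (planeLattice V) := ⟨hV⟩
  have hrank : Module.finrank ℤ (planeLattice V) = 2 := (ZLattice.rank ℝ _).trans hdim
  have : Module.Free ℤ (planeLattice V) := ZLattice.module_free ℝ _
  have : Module.Finite ℤ (planeLattice V) := ZLattice.module_finite ℝ _
  let b : Module.Basis (Fin 2) ℤ (planeLattice V) := Module.finBasisOfFinrankEq _ _ hrank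
  let B : Module.Basis (Fin 2) ℝ V := b.ofZLatticeBasis ℝ (planeLattice V)
  have hB : ∀ i, torusProj (B i : Fin 3 → ℝ) = 0 := fun i => by
    rw [← mem_planeLattice_iff, Module.Basis.ofZLatticeBasis_apply]
    exact (b i).2
  let φ : AddCircle (1 : ℝ) × AddCircle (1 : ℝ) →+ T3 :=
    (circleHom _ (hB 0)).coprod (circleHom _ (hB 1))
  have hφ : ∀ s t : ℝ, φ (s, t) = torusProj ((s • B 0 + t • B 1 : V) : Fin 3 → ℝ) := fun s t => by
    simp [φ, circleHom_coe]
  have hcont : Continuous φ :=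
    ((continuous_circleHom _ (hB 0)).comp continuous_fst).add
      ((continuous_circleHom _ (hB 1)).comp continuous_snd)
  have hinj : Function.Injective φ := by
    rw [injective_iff_map_eq_zero]
    rintro ⟨x, y⟩ h
    obtain ⟨s, rfl⟩ := QuotientAddGroup.mk_surjective x
    obtain ⟨t, rfl⟩ := QuotientAddGroup.mk_surjective y
    have h' := (hφ s t).symm.trans h
    rw [← mem_planeLattice_iff] at h'
    have hr := b.ofZLatticeBasis_repr_apply ℝ (planeLattice V) ⟨_, h'⟩
    have h0 := hr 0
    have h1 := hr 1
    change B.repr (s • B 0 + t • B 1) 0 = _ at h0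
    change B.repr (s • B 0 + t • B 1) 1 = _ at h1
    simp only [map_add, map_smul, Module.Basis.repr_self, Finsupp.add_apply, Finsupp.smul_apply,
      smul_eq_mul] at h0 h1
    simp at h0 h1
    refine Prod.ext ?_ ?_
    · exact AddCircle.coe_eq_zero_iff (1 : ℝ) |>.2 ⟨_, by simpa using h0.symm⟩
    · exact AddCircle.coe_eq_zero_iff (1 : ℝ) |>.2 ⟨_, by simpa using h1.symm⟩
  have hrange : Set.range φ = P '' (V : Set (Fin 3 → ℝ)) := by
    ext y
    constructor
    · rintro ⟨⟨x, y⟩, rfl⟩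
      obtain ⟨s, rfl⟩ := QuotientAddGroup.mk_surjective x
      obtain ⟨t, rfl⟩ := QuotientAddGroup.mk_surjective y
      exact ⟨_, (s • B 0 + t • B 1 : V).2, (hφ s t).symm⟩
    · rintro ⟨x, hx, rfl⟩
      refine ⟨((B.repr ⟨x, hx⟩ 0 : ℝ), (B.repr ⟨x, hx⟩ 1 : ℝ)), ?_⟩
      have := B.sum_repr ⟨x, hx⟩
      rw [Fin.sum_univ_two] at this
      rw [hφ, this]
      rfl
  have hemb := (hcont.isClosedEmbedding hinj).isEmbedding
  exact ⟨(Homeomorph.setCongr hrange.symm).trans hemb.toHomeomorph.symm⟩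

/-- **A plane in the 3-torus is a plane torus exactly when it is spanned by two
nonparallel integral vectors.**  Let `V` be a 2-dimensional linear subspace of
`ℝ³`.  The image `𝒫(V) ⊆ 𝕋³`, with the subspace topology, is homeomorphic to the
2-torus `(ℝ/ℤ)²` iff there exist two linearly independent integer vectors
`v₁, v₂ ∈ ℤ³` whose real span is `V`. -/
theorem image_plane_homeomorphic_two_torus_iff_integral_span
    (V : Submodule ℝ (Fin 3 → ℝ)) (hdim : Module.finrank ℝ V = 2) :
    Nonempty ((P '' (V : Set (Fin 3 → ℝ))) ≃ₜ (AddCircle (1 : ℝ) × AddCircle (1 : ℝ))) ↔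
    ∃ v₁ v₂ : Fin 3 → ℤ,
      LinearIndependent ℝ ![(fun i => ((v₁ i : ℤ) : ℝ)), (fun i => ((v₂ i : ℤ) : ℝ))] ∧
      V = Submodule.span ℝ {(fun i => ((v₁ i : ℤ) : ℝ)), (fun i => ((v₂ i : ℤ) : ℝ))} := by
  constructor
  · rintro ⟨e⟩
    have hcomp : CompactSpace (P '' (V : Set (Fin 3 → ℝ))) := e.symm.compactSpace
    have hV := span_planeLattice_eq_top_of_isCompact (isCompact_iff_compactSpace.2 hcomp)
    obtain ⟨f, hf, hspan, hli⟩ :=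
      Submodule.exists_fun_fin_finrank_span_eq ℝ (planeLattice V : Set V)
    replace hspan := hspan.trans hV
    generalize hn : Module.finrank ℝ (Submodule.span ℝ (planeLattice V : Set V)) = n at f hf hspan hli
    rw [hV, finrank_top, hdim] at hn
    subst hn
    have hint : ∀ i, ∃ v : Fin 3 → ℤ, (f i : Fin 3 → ℝ) = fun j => (v j : ℝ) := fun i =>
      (torusProj_eq_zero_iff _).1 ((mem_planeLattice_iff _).1 (hf i))
    choose v hv using hint
    have hfun : (![fun j => (v 0 j : ℝ), fun j => (v 1 j : ℝ)] : Fin 2 → Fin 3 → ℝ) =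
        V.subtype ∘ f := by
      funext i
      fin_cases i
      · exact (hv 0).symm
      · exact (hv 1).symm
    refine ⟨v 0, v 1, ?_, ?_⟩
    · rw [hfun]
      exact hli.map' V.subtype V.ker_subtype
    · rw [← Matrix.range_cons_cons_empty _ _ ![], hfun, Set.range_comp, ← Submodule.map_span,
        hspan, Submodule.map_subtype_top]
  · rintro ⟨v₁, v₂, -, hspan⟩
    refine nonempty_homeomorph_of_span_planeLattice_eq_top hdim ?_
    apply Submodule.map_injective_of_injective V.injective_subtype
    rw [Submodule.map_subtype_top]
    refine le_antisymm (Submodule.map_subtype_le _ _) ?_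
    conv_lhs => rw [hspan]
    rw [Submodule.span_le]
    have key : ∀ v : Fin 3 → ℤ, (fun i => (v i : ℝ)) ∈ V → (fun i => (v i : ℝ)) ∈
        Submodule.map V.subtype (Submodule.span ℝ (planeLattice V : Set V)) := fun v hv =>
      ⟨⟨_, hv⟩, Submodule.subset_span
        ((mem_planeLattice_iff _).2 ((torusProj_eq_zero_iff _).2 ⟨v, rfl⟩)), rfl⟩
    rintro x (rfl | rfl)
    · exact key v₁ (hspan ▸ Submodule.subset_span (by simp))
    · exact key v₂ (hspan ▸ Submodule.subset_span (by simp))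
end

section
/- Let Π be a 2-dimensional ℝ-linear subspace of ℝ³ that is spanned by two linearly independent integer vectors. Then there exist w₁, w₂ ∈ ℤ³ ∩ Π that span Π and such that the gcd of the components of the cross product w₁ × w₂ equals 1 (equivalently, such that the induced map (ℝ/ℤ)² → 𝕋³, (s,t) ↦ 𝒫(s·w₁ + t·w₂), is injective). -/
/-- The cast of an integer vector to a real vector. -/
def iv (v : Fin 3 → ℤ) : Fin 3 → ℝ := fun i => (v i : ℝ)

/-- Any two integers are a common multiple of a coprime pair, for which a Bézout relation holds. -/
lemma exists_eq_mul_bezout (a b : ℤ) :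
    ∃ g α β x y : ℤ, a = g * α ∧ b = g * β ∧ x * α + y * β = 1 := by
  by_cases h : a = 0 ∧ b = 0
  · exact ⟨0, 1, 0, 1, 0, by simp [h.1], by simp [h.2], by norm_num⟩
  · have hpos : 0 < Int.gcd a b := Int.gcd_pos_iff.2 (by tauto)
    obtain ⟨α, β, hco, ha, hb⟩ := Int.exists_gcd_one hpos
    obtain ⟨x, y, hxy⟩ := Int.isCoprime_iff_gcd_eq_one.2 hco
    exact ⟨Int.gcd a b, α, β, x, y, by rw [mul_comm]; exact ha, by rw [mul_comm]; exact hb, hxy⟩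

/-- Two integer vectors with vanishing cross product are linearly dependent over the reals. -/
lemma not_linearIndependent_of_minors_eq_zero (v w : Fin 3 → ℤ)
    (h₀ : v 1 * w 2 - v 2 * w 1 = 0) (h₁ : v 2 * w 0 - v 0 * w 2 = 0)
    (h₂ : v 0 * w 1 - v 1 * w 0 = 0) : ¬ LinearIndependent ℝ ![iv v, iv w] := by
  intro hli
  rw [LinearIndependent.pair_iff] at hli
  have hR : ∀ i j : Fin 3, (w j : ℝ) * v i - v j * w i = 0 := by
    intro i j
    have : w j * v i - v j * w i = 0 := by
      fin_cases i <;> fin_cases j <;> simp <;> linarith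
    exact_mod_cast this
  have hv : iv v = 0 := by
    funext j
    have := (hli (w j) (-v j) (by
      funext i
      have := hR i j
      simp only [iv, Pi.add_apply, Pi.smul_apply, smul_eq_mul, Pi.zero_apply]
      linarith)).2
    simpa [iv] using this
  exact one_ne_zero (hli 1 0 (by simp [hv])).1

/-- An integer vector orthogonal to `(g * α, g * β, c)` is a combination of the standard basis of
the orthogonal lattice. -/
lemma iv_mem_span_of_orthogonal {g c α β x y p q : ℤ} (hxy : x * α + y * β = 1)
    (hpq : p * g + q * c = 1) (v : Fin 3 → ℤ)
    (hv : g * α * v 0 + g * β * v 1 + c * v 2 = 0) :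
    iv v ∈ Submodule.span ℝ {iv ![β, -α, 0], iv ![-c * x, -c * y, g]} := by
  rw [Submodule.mem_span_pair]
  refine ⟨((y * v 0 - x * v 1 : ℤ) : ℝ), ((p * v 2 - q * (α * v 0 + β * v 1) : ℤ) : ℝ), ?_⟩
  have hct : c * (p * v 2 - q * (α * v 0 + β * v 1)) = -(α * v 0 + β * v 1) := by
    linear_combination p * hv - (α * v 0 + β * v 1) * hpq
  have hgt : g * (p * v 2 - q * (α * v 0 + β * v 1)) = v 2 := by
    linear_combination v 2 * hpq - q * hv
  set t := p * v 2 - q * (α * v 0 + β * v 1)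
  funext i
  simp only [iv, Pi.add_apply, Pi.smul_apply, smul_eq_mul]
  norm_cast
  fin_cases i
  · simp
    linear_combination v 0 * hxy - x * hct
  · simp
    linear_combination v 1 * hxy - y * hct
  · simp
    linear_combination hgt

/-- **Every rational plane is spanned by a primitive pair of integer vectors.**
If `V` is a 2-dimensional subspace of `ℝ³` spanned by two linearly independent
integer vectors, then there exist integer vectors `w₁, w₂` lying in `V`, spanning
`V`, such that the gcd of the components of the cross product `w₁ × w₂` (the three
2×2 minors) equals `1`. -/
theorem exists_primitive_integral_spanning_pair
    (V : Submodule ℝ (Fin 3 → ℝ)) (hdim : Module.finrank ℝ V = 2)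
    (hspan : ∃ v₁ v₂ : Fin 3 → ℤ,
      LinearIndependent ℝ ![iv v₁, iv v₂] ∧ V = Submodule.span ℝ {iv v₁, iv v₂}) :
    ∃ w₁ w₂ : Fin 3 → ℤ,
      iv w₁ ∈ V ∧ iv w₂ ∈ V ∧ V = Submodule.span ℝ {iv w₁, iv w₂} ∧
      Int.gcd (w₁ 0 * w₂ 1 - w₁ 1 * w₂ 0)
        (Int.gcd (w₁ 1 * w₂ 2 - w₁ 2 * w₂ 1) (w₁ 0 * w₂ 2 - w₁ 2 * w₂ 0)) = 1 := by
  obtain ⟨v₁, v₂, hli, hV⟩ := hspan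
  obtain ⟨G, α, β, x, y, hA, hB, hxy⟩ :=
    exists_eq_mul_bezout (v₁ 1 * v₂ 2 - v₁ 2 * v₂ 1) (v₁ 2 * v₂ 0 - v₁ 0 * v₂ 2)
  obtain ⟨D, g, c, p, q, hG, hC, hpq⟩ := exists_eq_mul_bezout G (v₁ 0 * v₂ 1 - v₁ 1 * v₂ 0)
  have hD : D ≠ 0 := by
    rintro rfl
    rw [zero_mul] at hG hC
    rw [hG, zero_mul] at hA hB
    exact not_linearIndependent_of_minors_eq_zero v₁ v₂ hA hB hC hli
  rw [hG] at hA hB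
  have hv₁ := iv_mem_span_of_orthogonal hxy hpq v₁ (mul_left_cancel₀ hD (by
    linear_combination -(v₁ 0) * hA - v₁ 1 * hB - v₁ 2 * hC))
  have hv₂ := iv_mem_span_of_orthogonal hxy hpq v₂ (mul_left_cancel₀ hD (by
    linear_combination -(v₂ 0) * hA - v₂ 1 * hB - v₂ 2 * hC))
  have hVW : V = Submodule.span ℝ {iv ![β, -α, 0], iv ![-c * x, -c * y, g]} := by
    refine Submodule.eq_of_le_of_finrank_le ?_ ?_
    · rw [hV, Submodule.span_le]
      exact Set.pair_subset hv₁ hv₂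
    · rw [hdim, ← Matrix.range_cons_cons_empty _ _ ![]]
      exact finrank_range_le_card _
  refine ⟨_, _, ?_, ?_, hVW, ?_⟩
  · rw [hVW]
    exact Submodule.subset_span (by simp)
  · rw [hVW]
    exact Submodule.subset_span (by simp)
  · simp only [Matrix.cons_val]
    rw [← Int.natCast_inj]
    refine Int.eq_one_of_dvd_one (by positivity) ?_
    have h₁ := Int.gcd_dvd_left (β * (-c * y) - -α * (-c * x))
      (Int.gcd (-α * g - 0 * (-c * y)) (β * g - 0 * (-c * x)))
    have h₂ := Int.gcd_dvd_right (β * (-c * y) - -α * (-c * x))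
      (Int.gcd (-α * g - 0 * (-c * y)) (β * g - 0 * (-c * x)))
    have h₃ := h₂.trans (Int.gcd_dvd_left _ _)
    have h₄ := h₂.trans (Int.gcd_dvd_right _ _)
    exact (dvd_add (dvd_add (h₁.mul_left (-q)) (h₃.mul_left (-p * x)))
      (h₄.mul_left (p * y))).trans (dvd_of_eq (by
        linear_combination hpq + (p * g + q * c) * hxy))
end

section
/- Let d ∈ ℝ³ be a nonzero vector, let p ∈ ℝ³, and let L = {p + t·d : t ∈ ℝ}. If the image 𝒫(L) is a compact subset of 𝕋³, then d is a real scalar multiple of some nonzero integer vector, i.e. there exist λ ∈ ℝ and w ∈ ℤ³ \ {0} with d = λ·w. (Every rod-shaped circle in the 3-torus is parallel to an integral vector.) -/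
/-- A continuous homomorphism from a noncompact σ-compact group onto a compact subgroup of a
Hausdorff group has nontrivial kernel. -/
theorem AddMonoidHom.not_injective_of_isCompact_range {G H : Type*}
    [AddGroup G] [TopologicalSpace G] [IsTopologicalAddGroup G] [SigmaCompactSpace G]
    [NoncompactSpace G] [AddGroup H] [TopologicalSpace H] [IsTopologicalAddGroup H] [T2Space H]
    (f : G →+ H) (hf : Continuous f) (hc : IsCompact (Set.range f)) :
    ¬ Function.Injective f := by
  intro hinj
  have : CompactSpace f.range := isCompact_iff_compactSpace.mp hc
  have hcont : Continuous f.rangeRestrict := hf.subtype_mk _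
  have hopen : IsOpenMap f.rangeRestrict :=
    f.rangeRestrict.isOpenMap_of_sigmaCompact f.rangeRestrict_surjective hcont
  have hbij : Function.Bijective f.rangeRestrict :=
    ⟨f.rangeRestrict_injective_iff.mpr hinj, f.rangeRestrict_surjective⟩
  have e : G ≃ₜ f.range := (Equiv.ofBijective _ hbij).toHomeomorphOfContinuousOpen hcont hopen
  exact not_compactSpace_iff.mpr ‹_› e.symm.compactSpace

/-- The one-parameter subgroup of the 3-torus in the direction `d`. -/
noncomputable def torusLine (d : Fin 3 → ℝ) : ℝ →+ T3 where
  toFun t := P (t • d)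
  map_zero' := by ext i; simp [P]
  map_add' s t := by ext i; simp [P, add_mul]

theorem continuous_torusLine (d : Fin 3 → ℝ) : Continuous (torusLine d) :=
  continuous_pi fun _ => (AddCircle.continuous_mk' 1).comp (continuous_id.mul continuous_const)

theorem range_torusLine (d p : Fin 3 → ℝ) :
    Set.range (torusLine d) = (fun x => -P p + x) '' (P '' {x | ∃ t : ℝ, x = p + t • d}) := by
  have key : ∀ t : ℝ, -P p + P (p + t • d) = torusLine d t := fun t => by
    ext i
    simp [P, torusLine]
  ext y
  constructor
  · rintro ⟨t, rfl⟩
    exact ⟨_, ⟨_, ⟨t, rfl⟩, rfl⟩, key t⟩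
  · rintro ⟨_, ⟨_, ⟨t, rfl⟩, rfl⟩, rfl⟩
    exact ⟨t, (key t).symm⟩

/-- **Every rod-shaped circle in the 3-torus is parallel to an integral vector.**
Let `d ∈ ℝ³` be nonzero, `p ∈ ℝ³`, and `L = {p + t • d : t ∈ ℝ}`.  If `𝒫(L)` is a
compact subset of `𝕋³`, then `d` is a real scalar multiple of a nonzero integer
vector. -/
theorem direction_rational_of_isCompact_image_line
    (d : Fin 3 → ℝ) (hd : d ≠ 0) (p : Fin 3 → ℝ)
    (L : Set (Fin 3 → ℝ)) (hL : L = {x | ∃ t : ℝ, x = p + t • d})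
    (hcompact : IsCompact (P '' L)) :
    ∃ (lam : ℝ) (w : Fin 3 → ℤ), w ≠ 0 ∧ d = lam • fun i => ((w i : ℤ) : ℝ) := by
  subst hL
  have hrange : IsCompact (Set.range (torusLine d)) := by
    rw [range_torusLine d p]
    exact hcompact.image (continuous_const_add (-P p))
  have hker := (torusLine d).not_injective_of_isCompact_range (continuous_torusLine d) hrange
  rw [injective_iff_map_eq_zero] at hker
  push Not at hker
  obtain ⟨t, ht, ht0⟩ := hker
  have hcoord : ∀ i, ∃ n : ℤ, (n : ℝ) = t * d i := fun i => by
    obtain ⟨n, hn⟩ := (AddCircle.coe_eq_zero_iff (1 : ℝ)).mp (congrFun ht i)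
    exact ⟨n, by simpa using hn⟩
  choose w hw using hcoord
  refine ⟨t⁻¹, w, ?_, ?_⟩
  · rintro rfl
    refine hd (funext fun i => ?_)
    simpa [ht0] using hw i
  · ext i
    simp [hw, ht0]
end

section
/- Let Π be a 2-dimensional ℝ-linear subspace of ℝ³ spanned by two linearly independent integer vectors, and let L₁, …, Lₙ be finitely many lines in ℝ³ each of whose direction vector is a nonzero integer vector lying in Π. Then there exists c ∈ ℝ³ such that the plane torus 𝒫(c + Π) is disjoint from each of the rods 𝒫(L₁), …, 𝒫(Lₙ) in 𝕋³. (If all rods have directions lying in a common rational plane, some parallel plane torus avoids all the rods.) -/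
open Matrix in
/-- The cross product of integer vectors is compatible with the cast to real vectors. -/
theorem iv_cross (u w : Fin 3 → ℤ) : iv u ⨯₃ iv w = iv (u ⨯₃ w) := by
  ext i
  fin_cases i <;> simp [iv, cross_apply]

open Matrix in
/-- Two points of `ℝ³` with the same image in `𝕋³` have dot products with an integer vector
that differ by an integer. -/
theorem exists_int_dotProduct_eq_of_P_eq (m : Fin 3 → ℤ) {x y : Fin 3 → ℝ} (h : P x = P y) :
    ∃ z : ℤ, iv m ⬝ᵥ x = iv m ⬝ᵥ y + z := by
  have hz (i : Fin 3) : ∃ z : ℤ, x i = y i + z := by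
    have hi : (x i : AddCircle (1 : ℝ)) = y i := congrFun h i
    obtain ⟨z, hz⟩ := AddSubgroup.mem_zmultiples_iff.1 (QuotientAddGroup.eq.1 hi.symm)
    exact ⟨z, by rw [zsmul_one] at hz; linarith⟩
  choose z hz using hz
  refine ⟨m ⬝ᵥ z, ?_⟩
  simp only [dotProduct, iv, hz, mul_add, Finset.sum_add_distrib]
  push_cast
  rfl

/-- **If all rods have directions lying in a common rational plane, some parallel
plane torus avoids all the rods.**  Let `V` be a plane in `ℝ³` spanned by two
linearly independent integer vectors, and let `L₁, …, Lₙ` be lines whose (nonzero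
integral) direction vectors lie in `V`.  Then some translate `c + V` projects to
a plane torus `𝒫(c + V)` disjoint from every rod `𝒫(Lₖ)`. -/
theorem exists_parallel_plane_torus_disjoint_from_rods
    (V : Submodule ℝ (Fin 3 → ℝ))
    (hV : ∃ u₁ u₂ : Fin 3 → ℤ,
      LinearIndependent ℝ ![iv u₁, iv u₂] ∧ V = Submodule.span ℝ {iv u₁, iv u₂})
    (n : ℕ) (p : Fin n → (Fin 3 → ℝ)) (v : Fin n → (Fin 3 → ℤ))
    (hv : ∀ k : Fin n, v k ≠ 0 ∧ iv (v k) ∈ V) :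
    ∃ c : Fin 3 → ℝ, ∀ k : Fin n,
      Disjoint (P '' {x | ∃ w ∈ V, x = c + w})
        (P '' {x | ∃ t : ℝ, x = p k + t • iv (v k)}) := by
  obtain ⟨u₁, u₂, hu, rfl⟩ := hV
  set m : Fin 3 → ℤ := crossProduct u₁ u₂
  have hm : iv m ≠ 0 := by
    rw [← iv_cross]
    exact crossProduct_ne_zero_iff_linearIndependent.2 hu
  have horth : ∀ w ∈ Submodule.span ℝ {iv u₁, iv u₂}, iv m ⬝ᵥ w = 0 := by
    intro w hw
    obtain ⟨a, b, rfl⟩ := Submodule.mem_span_pair.1 hw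
    rw [← iv_cross, dotProduct_add, dotProduct_smul, dotProduct_smul, dotProduct_comm,
      dot_self_cross, dotProduct_comm _ (iv u₂), dot_cross_self]
    simp
  have hcount : (⋃ k, Set.range fun z : ℤ => iv m ⬝ᵥ p k + z).Countable :=
    Set.countable_iUnion fun k => Set.countable_range _
  obtain ⟨r, hr⟩ := (hcount.dense_compl ℝ).nonempty
  refine ⟨(r / (iv m ⬝ᵥ iv m)) • iv m, fun k => Set.disjoint_left.2 ?_⟩
  rintro _ ⟨_, ⟨w, hw, rfl⟩, rfl⟩ ⟨_, ⟨t, rfl⟩, hP⟩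
  obtain ⟨z, hz⟩ := exists_int_dotProduct_eq_of_P_eq m hP.symm
  rw [dotProduct_add, dotProduct_smul, horth w hw, dotProduct_add, dotProduct_smul,
    horth _ (hv k).2, smul_eq_mul, div_mul_cancel₀ _ (mt dotProduct_self_eq_zero.1 hm),
    smul_zero, add_zero, add_zero] at hz
  exact hr (Set.mem_iUnion.2 ⟨k, z, hz.symm⟩)
end
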